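/- Let a ∈ 𝔻 \ {0}, set b := −a, and let γ ∈ ℂ satisfy |a|^{3/2} < |γ| < |a|. Then there exists δ > 0 such that for every ε ∈ ℂ with 0 < |ε| < δ, max{ 2·log|a| , log|γ| + log|(ε − γ)/(1 − ε̄γ)| } < L^ε_{aVbV}(0, γ). Since by Edigarian's product property the left-hand side equals the pluricomplex Green function of 𝔻² with the four simple poles (a,0), (b,0), (b,ε), (a,ε) (all weights equal to 1) evaluated at (0,γ), this gives a negative answer to Coman's conjecture for equal weights: the Green and Lempert functions with these four equally weighted poles differ at (0,γ). -/

import Mathlib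

open Complex Metric Filter Topology

noncomputable section

/-- The open unit disc in `ℂ`. -/
def unitDisc : Set ℂ := Metric.ball 0 1

/-- Extended-real logarithm, with the convention `log 0 = ⊥`. -/
def elog (x : ℝ) : EReal := if x = 0 then ⊥ else ((Real.log x : ℝ) : EReal)

/-- The Möbius involution of the unit disc exchanging `ξ` and `0`. -/
def mobius (ξ ζ : ℂ) : ℂ := (ξ - ζ) / (1 - (starRingEnd ℂ) ξ * ζ)

/-- An analytic disc in the bidisc `𝔻²`, given by its two components. -/
def AnalyticDisc2 (φ₁ φ₂ : ℂ → ℂ) : Prop :=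
  DifferentiableOn ℂ φ₁ unitDisc ∧ DifferentiableOn ℂ φ₂ unitDisc ∧
  (∀ w ∈ unitDisc, φ₁ w ∈ unitDisc) ∧ (∀ w ∈ unitDisc, φ₂ w ∈ unitDisc)

/-- The Lempert function with the two simple poles `(a,0)`, `(b,0)` in the bidisc. -/
def La0b0 (a b : ℂ) (z : ℂ × ℂ) : EReal :=
  sInf { t : EReal | ∃ (φ₁ φ₂ : ℂ → ℂ) (ζ₁ ζ₂ : ℂ),
    AnalyticDisc2 φ₁ φ₂ ∧ ζ₁ ∈ unitDisc ∧ ζ₂ ∈ unitDisc ∧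
    φ₁ 0 = z.1 ∧ φ₂ 0 = z.2 ∧
    φ₁ ζ₁ = a ∧ φ₂ ζ₁ = 0 ∧ φ₁ ζ₂ = b ∧ φ₂ ζ₂ = 0 ∧
    t = elog (‖ζ₁‖) + elog (‖ζ₂‖) }

/-- The generalized Lempert function with vertical indicator at `(a,0)` and
simple pole `(b,0)`. -/
def LaVb0 (a b : ℂ) (z : ℂ × ℂ) : EReal :=
  sInf { t : EReal | ∃ (φ₁ φ₂ : ℂ → ℂ) (ζ₁ ζ₂ : ℂ),
    AnalyticDisc2 φ₁ φ₂ ∧ ζ₁ ∈ unitDisc ∧ ζ₂ ∈ unitDisc ∧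
    φ₁ 0 = z.1 ∧ φ₂ 0 = z.2 ∧
    φ₁ ζ₁ = a ∧ φ₂ ζ₁ = 0 ∧ φ₁ ζ₂ = b ∧ φ₂ ζ₂ = 0 ∧
    deriv φ₁ ζ₁ = 0 ∧
    t = elog (‖ζ₁‖) + elog (‖ζ₁‖) + elog (‖ζ₂‖) }

/-- The generalized Lempert function with simple pole `(a,0)` and vertical
indicator at `(b,0)`. -/
def La0bV (a b : ℂ) (z : ℂ × ℂ) : EReal :=
  sInf { t : EReal | ∃ (φ₁ φ₂ : ℂ → ℂ) (ζ₁ ζ₂ : ℂ),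
    AnalyticDisc2 φ₁ φ₂ ∧ ζ₁ ∈ unitDisc ∧ ζ₂ ∈ unitDisc ∧
    φ₁ 0 = z.1 ∧ φ₂ 0 = z.2 ∧
    φ₁ ζ₁ = a ∧ φ₂ ζ₁ = 0 ∧ φ₁ ζ₂ = b ∧ φ₂ ζ₂ = 0 ∧
    deriv φ₁ ζ₂ = 0 ∧
    t = elog (‖ζ₁‖) + elog (‖ζ₂‖) + elog (‖ζ₂‖) }

/-- The generalized Lempert function with vertical indicators at `(a,0)` and `(b,0)`. -/
def LaVbV (a b : ℂ) (z : ℂ × ℂ) : EReal :=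
  sInf { t : EReal | ∃ (φ₁ φ₂ : ℂ → ℂ) (ζ₁ ζ₂ : ℂ),
    AnalyticDisc2 φ₁ φ₂ ∧ ζ₁ ∈ unitDisc ∧ ζ₂ ∈ unitDisc ∧
    φ₁ 0 = z.1 ∧ φ₂ 0 = z.2 ∧
    φ₁ ζ₁ = a ∧ φ₂ ζ₁ = 0 ∧ φ₁ ζ₂ = b ∧ φ₂ ζ₂ = 0 ∧
    deriv φ₁ ζ₁ = 0 ∧ deriv φ₁ ζ₂ = 0 ∧
    t = elog (‖ζ₁‖) + elog (‖ζ₁‖)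
        + elog (‖ζ₂‖) + elog (‖ζ₂‖) }

/-- Coman's Lempert function with the three simple poles `(a,0)`, `(b,0)`, `(b,ε)`. -/
def Leps3 (a b ε : ℂ) (z : ℂ × ℂ) : EReal :=
  sInf { t : EReal | ∃ (φ₁ φ₂ : ℂ → ℂ) (ζ₁ ζ₂ ζ₃ : ℂ),
    AnalyticDisc2 φ₁ φ₂ ∧ ζ₁ ∈ unitDisc ∧ ζ₂ ∈ unitDisc ∧ ζ₃ ∈ unitDisc ∧
    φ₁ 0 = z.1 ∧ φ₂ 0 = z.2 ∧
    φ₁ ζ₁ = a ∧ φ₂ ζ₁ = 0 ∧ φ₁ ζ₂ = b ∧ φ₂ ζ₂ = 0 ∧ φ₁ ζ₃ = b ∧ φ₂ ζ₃ = ε ∧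
    t = elog (‖ζ₁‖) + elog (‖ζ₂‖) + elog (‖ζ₃‖) }

/-- Coman's Lempert function with the four simple poles
`(a,0)`, `(b,0)`, `(b,ε)`, `(a,ε)`. -/
def Leps4 (a b ε : ℂ) (z : ℂ × ℂ) : EReal :=
  sInf { t : EReal | ∃ (φ₁ φ₂ : ℂ → ℂ) (ζ₁ ζ₂ ζ₃ ζ₄ : ℂ),
    AnalyticDisc2 φ₁ φ₂ ∧ ζ₁ ∈ unitDisc ∧ ζ₂ ∈ unitDisc ∧ ζ₃ ∈ unitDisc ∧ ζ₄ ∈ unitDisc ∧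
    φ₁ 0 = z.1 ∧ φ₂ 0 = z.2 ∧
    φ₁ ζ₁ = a ∧ φ₂ ζ₁ = 0 ∧ φ₁ ζ₂ = b ∧ φ₂ ζ₂ = 0 ∧
    φ₁ ζ₃ = b ∧ φ₂ ζ₃ = ε ∧ φ₁ ζ₄ = a ∧ φ₂ ζ₄ = ε ∧
    t = elog (‖ζ₁‖) + elog (‖ζ₂‖)
        + elog (‖ζ₃‖) + elog (‖ζ₄‖) }


lemma one_sub_conj_ne {x y : ℂ} (hx : ‖x‖ ≤ 1) (hy : ‖y‖ < 1) :
    1 - (starRingEnd ℂ) x * y ≠ 0 := by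
  intro h
  have h1 : (starRingEnd ℂ) x * y = 1 := by linear_combination -h
  have h2 : ‖x‖ * ‖y‖ = 1 := by
    have := congrArg norm h1
    simpa using this
  nlinarith [norm_nonneg x, norm_nonneg y]

lemma norm_id (x y : ℂ) : ‖1 - (starRingEnd ℂ) x * y‖ ^ 2 =
    ‖x - y‖ ^ 2 + (1 - ‖x‖ ^ 2) * (1 - ‖y‖ ^ 2) := by
  simp only [← Complex.normSq_eq_norm_sq, Complex.normSq_apply]
  simp
  ring

lemma mob_norm_lt {x y : ℂ} (hx : ‖x‖ < 1) (hy : ‖y‖ < 1) : ‖mobius x y‖ < 1 := by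
  have h0 := one_sub_conj_ne hx.le hy
  have h := norm_id x y
  unfold mobius
  rw [norm_div, div_lt_one (norm_pos_iff.2 h0)]
  have h3 : 0 < (1 - ‖x‖ ^ 2) * (1 - ‖y‖ ^ 2) := by
    apply mul_pos <;> nlinarith [norm_nonneg x, norm_nonneg y]
  exact lt_of_pow_lt_pow_left₀ 2 (norm_nonneg _) (by linarith)

lemma mob_invol {x y : ℂ} (hx : ‖x‖ < 1) (hy : ‖y‖ < 1) : mobius x (mobius x y) = y := by
  have h0 := one_sub_conj_ne hx.le hy
  have h1 := one_sub_conj_ne hx.le hx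
  have h2 := one_sub_conj_ne hx.le (mob_norm_lt hx hy)
  unfold mobius at h2 ⊢
  generalize (starRingEnd ℂ) x = c at *
  rw [div_eq_iff h2]
  rw [mul_comm c y] at h0 ⊢
  field_simp
  ring

lemma mob_diff {x : ℂ} (hx : ‖x‖ < 1) : DifferentiableOn ℂ (mobius x) (ball 0 1) := by
  unfold mobius
  intro y hy
  have := one_sub_conj_ne hx.le (mem_ball_zero_iff.1 hy)
  apply DifferentiableAt.differentiableWithinAt
  fun_prop (disch := assumption)

lemma mob_symm (x y : ℂ) : ‖mobius x y‖ = ‖mobius y x‖ := by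
  unfold mobius
  rw [norm_div, norm_div, norm_sub_rev]
  congr 1
  rw [← Complex.norm_conj]
  simp [mul_comm]

lemma mob_zero (x : ℂ) : mobius x 0 = x := by simp [mobius]

lemma mob_self (x : ℂ) : mobius x x = 0 := by simp [mobius]

lemma mob_ne {x y : ℂ} (hx : ‖x‖ < 1) (hy : ‖y‖ < 1) (h : x ≠ y) : mobius x y ≠ 0 := by
  unfold mobius
  exact div_ne_zero (sub_ne_zero.2 h) (one_sub_conj_ne hx.le hy)

/-- Self-maps of the disc, closed target. -/
def SM (f : ℂ → ℂ) : Prop :=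
  DifferentiableOn ℂ f (ball 0 1) ∧ ∀ z, ‖z‖ < 1 → ‖f z‖ ≤ 1

lemma SM.divide {f : ℂ → ℂ} (hf : SM f) {u : ℂ} (hu : ‖u‖ < 1) (h0 : f u = 0) :
    ∃ g, SM g ∧ ∀ z, ‖z‖ < 1 → f z = mobius u z * g z := by
  have hm : Set.MapsTo (mobius u) (ball 0 1) (ball 0 1) := fun z hz =>
    mem_ball_zero_iff.2 (mob_norm_lt hu (mem_ball_zero_iff.1 hz))
  set F : ℂ → ℂ := f ∘ mobius u with hF
  have hFd : DifferentiableOn ℂ F (ball 0 1) := hf.1.comp (mob_diff hu) hm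
  have hF0 : F 0 = 0 := by simp [hF, mob_zero, h0]
  have hmaps : Set.MapsTo F (ball 0 1) (closedBall (F 0) 1) := by
    intro z hz
    rw [hF0, mem_closedBall_zero_iff]
    exact hf.2 _ (mem_ball_zero_iff.1 (hm hz))
  refine ⟨dslope F 0 ∘ mobius u, ⟨?_, ?_⟩, ?_⟩
  · refine DifferentiableOn.comp ?_ (mob_diff hu) hm
    exact (Complex.differentiableOn_dslope (ball_mem_nhds 0 one_pos)).2 hFd
  · intro z hz
    have := Complex.norm_dslope_le_div_of_mapsTo_ball hFd hmaps (hm (mem_ball_zero_iff.2 hz))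
    simpa using this
  · intro z hz
    have := sub_smul_dslope F 0 (mobius u z)
    simp only [sub_zero, hF0, smul_eq_mul] at this
    simp only [Function.comp]
    rw [this]
    simp [hF, mob_invol hu hz]

lemma SM.divide2 {f : ℂ → ℂ} (hf : SM f) {u v : ℂ} (hu : ‖u‖ < 1) (hv : ‖v‖ < 1) (huv : u ≠ v)
    (h0 : f u = 0) (h1 : f v = 0) :
    ∃ g, SM g ∧ ∀ z, ‖z‖ < 1 → f z = mobius u z * mobius v z * g z := by
  obtain ⟨g, hg, e⟩ := hf.divide hu h0
  have : g v = 0 := by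
    have := e v hv
    rw [h1] at this
    exact (mul_eq_zero.1 this.symm).resolve_left (mob_ne hu hv huv)
  obtain ⟨k, hk, e2⟩ := hg.divide hv this
  exact ⟨k, hk, fun z hz => by rw [e z hz, e2 z hz]; ring⟩

lemma SM.mob {f : ℂ → ℂ} (hd : DifferentiableOn ℂ f (ball 0 1))
    (hf : ∀ z, ‖z‖ < 1 → ‖f z‖ < 1) {u : ℂ} (hu : ‖u‖ < 1) : SM (fun z => mobius u (f z)) := by
  refine ⟨?_, fun z hz => (mob_norm_lt hu (hf z hz)).le⟩
  exact (mob_diff hu).comp hd fun z hz => mem_ball_zero_iff.2 (hf z (mem_ball_zero_iff.1 hz))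

lemma pick_open {g : ℂ → ℂ} (hd : DifferentiableOn ℂ g (ball 0 1))
    (hg : ∀ z, ‖z‖ < 1 → ‖g z‖ < 1) {z : ℂ} (hz : ‖z‖ < 1) :
    ‖g 0 - g z‖ ≤ ‖z‖ * ‖1 - (starRingEnd ℂ) (g 0) * g z‖ := by
  have h00 : ‖g 0‖ < 1 := hg 0 (by simp)
  obtain ⟨k, hk, e⟩ := (SM.mob hd hg h00).divide (u := 0) (by simp) (mob_self _)
  have h1 := e z hz
  have h2 := one_sub_conj_ne h00.le (hg z hz)
  have h3 : ‖mobius (g 0) (g z)‖ ≤ ‖z‖ := by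
    have : mobius 0 z = -z := by simp [mobius]
    rw [h1, this, norm_mul, norm_neg]
    exact mul_le_of_le_one_right (norm_nonneg _) (hk.2 z hz)
  unfold mobius at h3
  rwa [norm_div, div_le_iff₀ (norm_pos_iff.2 h2)] at h3

lemma SM.pick {g : ℂ → ℂ} (hg : SM g) {z : ℂ} (hz : ‖z‖ < 1) :
    ‖g 0 - g z‖ ≤ ‖z‖ * ‖1 - (starRingEnd ℂ) (g 0) * g z‖ := by
  have key : ∀ s : ℝ, s ∈ Set.Ioo (0:ℝ) 1 → ‖s * g 0 - s * g z‖ ≤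
      ‖z‖ * ‖1 - (starRingEnd ℂ) (s * g 0) * (s * g z)‖ := by
    intro s hs
    refine pick_open (g := fun z => s * g z) (hg.1.const_mul _) ?_ hz
    intro w hw
    rw [norm_mul, Complex.norm_real, Real.norm_of_nonneg hs.1.le]
    have := hg.2 w hw
    nlinarith [hs.1, hs.2]
  have hne : (𝓝[<] (1:ℝ)).NeBot := inferInstance
  have ev : ∀ᶠ s in 𝓝[<] (1:ℝ), s ∈ Set.Ioo (0:ℝ) 1 := Ioo_mem_nhdsLT (by norm_num)
  have t1 : Tendsto (fun s : ℝ => ‖s * g 0 - s * g z‖) (𝓝[<] (1:ℝ)) (𝓝 ‖((1:ℝ):ℂ) * g 0 - ((1:ℝ):ℂ) * g z‖) :=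
    (Continuous.tendsto (by fun_prop) 1).mono_left nhdsWithin_le_nhds
  have t2 : Tendsto (fun s : ℝ => ‖z‖ * ‖1 - (starRingEnd ℂ) (s * g 0) * (s * g z)‖) (𝓝[<] (1:ℝ))
      (𝓝 (‖z‖ * ‖1 - (starRingEnd ℂ) (((1:ℝ):ℂ) * g 0) * (((1:ℝ):ℂ) * g z)‖)) := by
    refine (Continuous.tendsto ?_ 1).mono_left nhdsWithin_le_nhds
    simp only [map_mul, Complex.conj_ofReal]
    fun_prop
  have := le_of_tendsto_of_tendsto t1 t2 (ev.mono key)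
  simpa using this

lemma SM.pick_lin {g : ℂ → ℂ} (hg : SM g) {z : ℂ} (hz : ‖z‖ < 1) :
    ‖g 0‖ ≤ ‖z‖ + 2 * ‖g z‖ := by
  have h := hg.pick hz
  have h0 := hg.2 0 (by simp)
  have h1 : ‖1 - (starRingEnd ℂ) (g 0) * g z‖ ≤ 1 + ‖g z‖ := by
    refine (norm_sub_le _ _).trans ?_
    rw [norm_one, norm_mul, Complex.norm_conj]
    nlinarith [norm_nonneg (g z)]
  have h2 : ‖g 0‖ ≤ ‖g 0 - g z‖ + ‖g z‖ := by
    have := norm_add_le (g 0 - g z) (g z); simpa using this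
  nlinarith [norm_nonneg (g z), norm_nonneg z]

lemma SM.pick_sq {g : ℂ → ℂ} (hg : SM g) {z : ℂ} (hz : ‖z‖ < 1) :
    ‖g 0 - g z‖ ^ 2 * (1 - ‖z‖ ^ 2) ≤ 1 - ‖g 0‖ ^ 2 := by
  have h := pow_le_pow_left₀ (norm_nonneg _) (hg.pick hz) 2
  rw [mul_pow, norm_id] at h
  have h0 := hg.2 0 (by simp)
  have a1 : 0 ≤ 1 - ‖g 0‖ ^ 2 := by nlinarith [norm_nonneg (g 0)]
  have a2 : (1 - ‖g 0‖ ^ 2) * (1 - ‖g z‖ ^ 2) ≤ 1 - ‖g 0‖ ^ 2 := by nlinarith [sq_nonneg ‖g z‖]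
  have a3 : ‖z‖ ^ 2 * ((1 - ‖g 0‖ ^ 2) * (1 - ‖g z‖ ^ 2)) ≤ 1 - ‖g 0‖ ^ 2 := by
    have b1 : ‖z‖^2 ≤ 1 := by nlinarith [norm_nonneg z]
    have b2 : 0 ≤ (1 - ‖g 0‖ ^ 2) * (1 - ‖g z‖ ^ 2) := by
      refine mul_nonneg a1 ?_
      have := hg.2 z hz
      nlinarith [norm_nonneg (g z)]
    nlinarith
  nlinarith

/-- Three-point estimate. -/
lemma SM.three {h : ℂ → ℂ} (hh : SM h) {x y z : ℂ} (hx : ‖x‖ < 1) (hy : ‖y‖ < 1) (hz : ‖z‖ < 1)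
    (hxy : x ≠ y) (h0 : h x = 0) (h1 : h y = 0) {c d : ℝ} (hc : 0 < c) (hd : 0 < d)
    (hc' : c ≤ ‖mobius x z‖) (hd' : d ≤ ‖mobius y z‖) :
    ‖h 0‖ ≤ ‖x‖ * ‖y‖ * ‖z‖ + 2 * ‖h z‖ / (c * d) := by
  obtain ⟨k, hk, e⟩ := hh.divide2 hx hy hxy h0 h1
  have e0 := e 0 (by simp)
  have ez := congrArg norm (e z hz)
  rw [mob_zero, mob_zero] at e0
  rw [norm_mul, norm_mul] at ez
  have p := hk.pick_lin hz
  have hkz : ‖k z‖ ≤ ‖h z‖ / (c * d) := by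
    rw [le_div_iff₀ (by positivity), ez]
    have : c * d ≤ ‖mobius x z‖ * ‖mobius y z‖ := by gcongr
    nlinarith [norm_nonneg (k z)]
  rw [e0, norm_mul, norm_mul]
  have q : ‖x‖ * ‖y‖ ≤ 1 := by nlinarith [norm_nonneg x, norm_nonneg y]
  have q0 : 0 ≤ ‖x‖ * ‖y‖ := by positivity
  have : 2 * ‖h z‖ / (c * d) = 2 * (‖h z‖ / (c * d)) := by ring
  rw [this]
  have hk0 := norm_nonneg (k z)
  calc ‖x‖ * ‖y‖ * ‖k 0‖ ≤ ‖x‖ * ‖y‖ * (‖z‖ + 2 * ‖k z‖) := by gcongr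
    _ = ‖x‖ * ‖y‖ * ‖z‖ + ‖x‖ * ‖y‖ * (2 * ‖k z‖) := by ring
    _ ≤ ‖x‖ * ‖y‖ * ‖z‖ + 1 * (2 * ‖k z‖) := by gcongr
    _ ≤ _ := by linarith

lemma mob_neg_self (a : ℂ) : mobius a (-a) = 2 * a / (1 + (‖a‖:ℂ) ^ 2) := by
  unfold mobius
  have : (starRingEnd ℂ) a * a = (‖a‖:ℂ) ^ 2 := by
    rw [mul_comm, Complex.mul_conj, Complex.normSq_eq_norm_sq]; push_cast; rfl
  rw [mul_neg, this]; ring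

/-- Information from the first component. -/
lemma half {f : ℂ → ℂ} (hd : DifferentiableOn ℂ f (ball 0 1))
    (hf : ∀ z, ‖z‖ < 1 → ‖f z‖ < 1) {a u v z : ℂ} (ha : ‖a‖ < 1)
    (hu : ‖u‖ < 1) (hv : ‖v‖ < 1) (hz : ‖z‖ < 1) (huv : u ≠ v) (f0 : f 0 = 0)
    (fu : f u = a) (fv : f v = a) (fz : f z = -a) (ha0 : a ≠ 0) :
    ‖a‖ ≤ ‖u‖ * ‖v‖ ∧ ‖mobius a (-a)‖ ≤ ‖mobius u z‖ ∧ ‖mobius a (-a)‖ ≤ ‖mobius v z‖ ∧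
    ‖a / (u * v) - mobius a (-a) / (mobius u z * mobius v z)‖ ^ 2 * (1 - ‖z‖ ^ 2) ≤
      1 - ‖a / (u * v)‖ ^ 2 := by
  obtain ⟨g, hg, e⟩ := (SM.mob hd hf ha).divide2 hu hv huv (by simp [fu, mob_self])
    (by simp [fv, mob_self])
  have e0 := e 0 (by simp)
  have ez := e z hz
  simp only [f0, fz, mob_zero] at e0 ez
  have u0 : u ≠ 0 := by rintro rfl; exact ha0 (fu.symm.trans f0)
  have v0 : v ≠ 0 := by rintro rfl; exact ha0 (fv.symm.trans f0)
  have nz : ∀ x, f x = a → x ≠ z := by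
    rintro x hx rfl
    apply ha0
    have : a = -a := hx.symm.trans fz
    exact self_eq_neg.1 this
  have m1 := mob_ne hu hz (nz u fu)
  have m2 := mob_ne hv hz (nz v fv)
  have g0 : g 0 = a / (u * v) := by rw [e0]; field_simp
  have gz : g z = mobius a (-a) / (mobius u z * mobius v z) := by rw [ez]; field_simp
  have b0 := hg.2 0 (by simp)
  have bz := hg.2 z hz
  have c1 := (mob_norm_lt hu hz).le
  have c2 := (mob_norm_lt hv hz).le
  refine ⟨?_, ?_, ?_, ?_⟩
  · rw [e0, norm_mul, norm_mul]
    exact mul_le_of_le_one_right (by positivity) b0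
  · rw [ez, norm_mul, norm_mul, mul_assoc]
    exact mul_le_of_le_one_right (by positivity) (mul_le_one₀ c2 (norm_nonneg _) bz)
  · rw [ez, norm_mul, norm_mul, mul_comm ‖mobius u z‖, mul_assoc]
    exact mul_le_of_le_one_right (by positivity) (mul_le_one₀ c1 (norm_nonneg _) bz)
  · have := hg.pick_sq hz
    rwa [g0, gz] at this

lemma mob_tendsto {u z : ℕ → ℂ} {q p : ℂ} (hu : Tendsto u atTop (𝓝 q)) (hz : Tendsto z atTop (𝓝 p))
    (hq : ‖q‖ < 1) (hp : ‖p‖ < 1) : Tendsto (fun n => mobius (u n) (z n)) atTop (𝓝 (mobius q p)) := by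
  unfold mobius
  refine (hu.sub hz).div (tendsto_const_nhds.sub ?_) (one_sub_conj_ne hq.le hp)
  exact ((Complex.continuous_conj.tendsto q).comp hu).mul hz

lemma half_limit {a : ℂ} (ha0 : a ≠ 0) {u v z : ℕ → ℂ} {q p : ℂ}
    (hu : Tendsto u atTop (𝓝 q)) (hv : Tendsto v atTop (𝓝 q)) (hz : Tendsto z atTop (𝓝 p))
    (hq : ‖q‖ < 1) (hp : ‖p‖ < 1) (hqa : ‖q‖ ^ 2 = ‖a‖)
    (h1 : ∀ n, ‖mobius a (-a)‖ ≤ ‖mobius (u n) (z n)‖)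
    (h2 : ∀ n, ‖a / (u n * v n) - mobius a (-a) / (mobius (u n) (z n) * mobius (v n) (z n))‖ ^ 2
      * (1 - ‖z n‖ ^ 2) ≤ 1 - ‖a / (u n * v n)‖ ^ 2) :
    (q - p) ^ 2 * (1 + (‖a‖:ℂ) ^ 2) = 2 * q ^ 2 * (1 - (starRingEnd ℂ) q * p) ^ 2 := by
  have w0 : mobius a (-a) ≠ 0 := by
    rw [mob_neg_self]
    refine div_ne_zero (by simpa using ha0) ?_
    have : (1 + ‖a‖ ^ 2 : ℝ) ≠ 0 := by positivity
    exact_mod_cast this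
  have q0 : q ≠ 0 := by
    rintro rfl
    apply ha0
    rw [← norm_eq_zero, ← hqa]; simp
  have tu := mob_tendsto hu hz hq hp
  have tv := mob_tendsto hv hz hq hp
  have m0 : mobius q p ≠ 0 := by
    have := ge_of_tendsto tu.norm (Eventually.of_forall h1)
    intro h
    rw [h, norm_zero] at this
    exact w0 (norm_le_zero_iff.1 this)
  have t1 : Tendsto (fun n => a / (u n * v n)) atTop (𝓝 (a / (q * q))) :=
    tendsto_const_nhds.div (hu.mul hv) (mul_ne_zero q0 q0)
  have t2 : Tendsto (fun n => mobius a (-a) / (mobius (u n) (z n) * mobius (v n) (z n))) atTop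
      (𝓝 (mobius a (-a) / (mobius q p * mobius q p))) :=
    tendsto_const_nhds.div (tu.mul tv) (mul_ne_zero m0 m0)
  have L := le_of_tendsto_of_tendsto' ((((t1.sub t2).norm).pow 2).mul
    (tendsto_const_nhds.sub (hz.norm.pow 2))) (tendsto_const_nhds.sub (t1.norm.pow 2)) h2
  have e1 : ‖a / (q * q)‖ = 1 := by
    rw [norm_div, norm_mul, ← hqa, ← pow_two, div_self]
    exact pow_ne_zero _ (norm_ne_zero_iff.2 q0)
  rw [e1] at L
  have p1 : 0 < 1 - ‖p‖ ^ 2 := by nlinarith [norm_nonneg p]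
  have e2 : a / (q * q) = mobius a (-a) / (mobius q p * mobius q p) := by
    rw [← sub_eq_zero, ← norm_eq_zero]
    by_contra hne
    have := pow_pos (lt_of_le_of_ne (norm_nonneg _) (Ne.symm hne)) 2
    nlinarith
  rw [mob_neg_self, div_eq_div_iff (mul_ne_zero q0 q0) (mul_ne_zero m0 m0)] at e2
  have d0 := one_sub_conj_ne hq.le hp
  have s0 : (1 + (‖a‖:ℂ) ^ 2) ≠ 0 := by
    have : (1 + ‖a‖ ^ 2 : ℝ) ≠ 0 := by positivity
    exact_mod_cast this
  unfold mobius at e2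
  generalize (starRingEnd ℂ) q = c at *
  rw [mul_comm c p] at d0 e2
  field_simp at e2
  linear_combination e2

lemma alg_contra {q p : ℂ} {t : ℝ} (t0 : 0 < t) (t1 : t < 1) (hq : ‖q‖ ^ 2 = t) (hp : ‖p‖ ^ 2 = t)
    (e1 : (q - p) ^ 2 * (1 + (t:ℂ) ^ 2) = 2 * q ^ 2 * (1 - (starRingEnd ℂ) q * p) ^ 2)
    (e2 : (p - q) ^ 2 * (1 + (t:ℂ) ^ 2) = 2 * p ^ 2 * (1 - (starRingEnd ℂ) p * q) ^ 2) : False := by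
  have cq : q * (starRingEnd ℂ) q = t := by
    rw [Complex.mul_conj, Complex.normSq_eq_norm_sq, hq]
  have cp : p * (starRingEnd ℂ) p = t := by
    rw [Complex.mul_conj, Complex.normSq_eq_norm_sq, hp]
  have q0 : q ≠ 0 := by
    rintro rfl; simp at hq; linarith
  have tm : (1 - (t:ℂ)) ≠ 0 := by
    have : (1 - t) ≠ 0 := by linarith
    exact_mod_cast this
  have tp : (1 + (t:ℂ)) ≠ 0 := by
    have : (1 + t) ≠ 0 := by linarith
    exact_mod_cast this
  have f1 : q * (1 - (starRingEnd ℂ) q * p) = q - t * p := by linear_combination -p * cq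
  have f2 : p * (1 - (starRingEnd ℂ) p * q) = p - t * q := by linear_combination -q * cp
  have g1 : (q - p) ^ 2 * (1 + (t:ℂ) ^ 2) = 2 * (q - t * p) ^ 2 := by rw [e1, ← f1]; ring
  have g2 : (p - q) ^ 2 * (1 + (t:ℂ) ^ 2) = 2 * (p - t * q) ^ 2 := by rw [e2, ← f2]; ring
  have g3 : ((1 + t) * (q - p)) * ((1 - t) * (q + p)) = 0 := by
    linear_combination (g2 - g1) / 2
  rcases mul_eq_zero.1 g3 with h | h
  · have : q = p := sub_eq_zero.1 ((mul_eq_zero.1 h).resolve_left tp)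
    subst this
    have : (2 * q ^ 2 * (1 - (t:ℂ)) ^ 2) = 0 := by linear_combination -g1
    exact (mul_ne_zero (mul_ne_zero two_ne_zero (pow_ne_zero _ q0)) (pow_ne_zero _ tm)) this
  · have : p = -q := by
      have := (mul_eq_zero.1 h).resolve_left tm
      linear_combination this
    subst this
    have : (2 * q ^ 2 * (1 - (t:ℂ)) ^ 2) = 0 := by linear_combination g1
    exact (mul_ne_zero (mul_ne_zero two_ne_zero (pow_ne_zero _ q0)) (pow_ne_zero _ tm)) this

lemma dist_le_of_mob {x y : ℂ} (hx : ‖x‖ < 1) (hy : ‖y‖ < 1) {η : ℝ} (h : ‖mobius x y‖ < η) :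
    ‖x - y‖ ≤ 2 * η := by
  have h0 := one_sub_conj_ne hx.le hy
  have h2 : ‖1 - (starRingEnd ℂ) x * y‖ ≤ 2 := by
    refine (norm_sub_le _ _).trans ?_
    rw [norm_one, norm_mul, Complex.norm_conj]
    nlinarith [norm_nonneg x, norm_nonneg y]
  unfold mobius at h
  rw [norm_div, div_lt_iff₀ (norm_pos_iff.2 h0)] at h
  have : 0 < η := by
    by_contra hn
    nlinarith [norm_nonneg (x - y), norm_nonneg (1 - (starRingEnd ℂ) x * y)]
  nlinarith

/-- The data of the first component. -/
structure Data (a : ℂ) (f : ℂ → ℂ) (z1 z2 z3 z4 : ℂ) : Prop where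
  hd : DifferentiableOn ℂ f (ball 0 1)
  hf : ∀ z, ‖z‖ < 1 → ‖f z‖ < 1
  b1 : ‖z1‖ < 1
  b2 : ‖z2‖ < 1
  b3 : ‖z3‖ < 1
  b4 : ‖z4‖ < 1
  f0 : f 0 = 0
  f1 : f z1 = a
  f2 : f z2 = -a
  f3 : f z3 = -a
  f4 : f z4 = a
  n14 : z1 ≠ z4
  n23 : z2 ≠ z3

lemma Data.swap {a : ℂ} {f : ℂ → ℂ} {z1 z2 z3 z4 : ℂ} (D : Data a f z1 z2 z3 z4) :
    Data a (fun z => - f z) z2 z1 z4 z3 :=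
  { hd := D.hd.neg
    hf := fun z hz => by simpa using D.hf z hz
    b1 := D.b2, b2 := D.b1, b3 := D.b4, b4 := D.b3
    f0 := by simp [D.f0]
    f1 := by simp [D.f2]
    f2 := by simp [D.f1]
    f3 := by simp [D.f4]
    f4 := by simp [D.f3]
    n14 := D.n23
    n23 := D.n14 }

lemma degenerate {a : ℂ} (ha : ‖a‖ < 1) (ha0 : a ≠ 0) :
    ∃ η > 0, ∀ f z1 z2 z3 z4, Data a f z1 z2 z3 z4 →
      ‖z1‖ * ‖z4‖ ≤ ‖a‖ * (1 + η) → ‖z2‖ * ‖z3‖ ≤ ‖a‖ * (1 + η) →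
      ‖mobius z1 z4‖ < η → ‖mobius z2 z3‖ < η → False := by
  by_contra! H
  have Hseq : ∀ n : ℕ, _ := fun n => H (1 / ((n:ℝ) + 1)) Nat.one_div_pos_of_nat
  choose f z1 z2 z3 z4 D k1 k2 k3 k4 using Hseq
  have hcomp : IsCompact (closedBall (0:ℂ) 1 ×ˢ closedBall (0:ℂ) 1) :=
    (isCompact_closedBall _ _).prod (isCompact_closedBall _ _)
  obtain ⟨⟨q, p⟩, -, s, hs, ht⟩ := hcomp.tendsto_subseq (x := fun n => (z1 n, z2 n)) (fun n =>
    ⟨mem_closedBall_zero_iff.2 (D n).b1.le, mem_closedBall_zero_iff.2 (D n).b2.le⟩)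
  have t1 : Tendsto (fun n => z1 (s n)) atTop (𝓝 q) := (continuous_fst.tendsto _).comp ht
  have t2 : Tendsto (fun n => z2 (s n)) atTop (𝓝 p) := (continuous_snd.tendsto _).comp ht
  have te : Tendsto (fun n => 1 / ((s n : ℝ) + 1)) atTop (𝓝 0) :=
    tendsto_one_div_add_atTop_nhds_zero_nat.comp hs.tendsto_atTop
  have te2 : Tendsto (fun n => 2 * (1 / ((s n : ℝ) + 1))) atTop (𝓝 0) := by
    simpa using te.const_mul 2
  have t4 : Tendsto (fun n => z4 (s n)) atTop (𝓝 q) := by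
    have : Tendsto (fun n => z1 (s n) - z4 (s n)) atTop (𝓝 0) :=
      squeeze_zero_norm (fun n => dist_le_of_mob (D _).b1 (D _).b4 (k3 _)) te2
    simpa using t1.sub this
  have t3 : Tendsto (fun n => z3 (s n)) atTop (𝓝 p) := by
    have : Tendsto (fun n => z2 (s n) - z3 (s n)) atTop (𝓝 0) :=
      squeeze_zero_norm (fun n => dist_le_of_mob (D _).b2 (D _).b3 (k4 _).1) te2
    simpa using t2.sub this
  have A := fun n => half (D n).hd (D n).hf ha (D n).b1 (D n).b4 (D n).b2 (D n).n14 (D n).f0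
    (D n).f1 (D n).f4 (D n).f2 ha0
  have B := fun n => half (D n).swap.hd (D n).swap.hf ha (D n).b2 (D n).b3 (D n).b1 (D n).n23
    (D n).swap.f0 (D n).swap.f1 (D n).swap.f4 (D n).swap.f2 ha0
  have tr : Tendsto (fun n => ‖a‖ * (1 + 1 / ((s n : ℝ) + 1))) atTop (𝓝 ‖a‖) := by
    simpa using (te.const_add 1).const_mul ‖a‖
  have nq : ‖q‖ ^ 2 = ‖a‖ := by
    rw [pow_two]
    exact le_antisymm (le_of_tendsto_of_tendsto' (t1.norm.mul t4.norm) tr fun n => k1 _)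
      (ge_of_tendsto' (t1.norm.mul t4.norm) fun n => (A _).1)
  have np : ‖p‖ ^ 2 = ‖a‖ := by
    rw [pow_two]
    exact le_antisymm (le_of_tendsto_of_tendsto' (t2.norm.mul t3.norm) tr fun n => k2 _)
      (ge_of_tendsto' (t2.norm.mul t3.norm) fun n => (B _).1)
  have lq : ‖q‖ < 1 := by nlinarith [norm_nonneg q]
  have lp : ‖p‖ < 1 := by nlinarith [norm_nonneg p]
  exact alg_contra (norm_pos_iff.2 ha0) ha nq np
    (half_limit ha0 t1 t4 t2 lq lp nq (fun n => (A _).2.1) fun n => (A _).2.2.2)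
    (half_limit ha0 t2 t3 t1 lp lq np (fun n => (B _).2.1) fun n => (B _).2.2.2)

lemma sep_case {h : ℂ → ℂ} (hd : DifferentiableOn ℂ h (ball 0 1))
    (hh : ∀ z, ‖z‖ < 1 → ‖h z‖ < 1) {z1 z2 z3 z4 ε : ℂ}
    (b1 : ‖z1‖ < 1) (b2 : ‖z2‖ < 1) (b3 : ‖z3‖ < 1) (b4 : ‖z4‖ < 1)
    (n12 : z1 ≠ z2) (n34 : z3 ≠ z4) (he : ‖ε‖ < 1)
    (h1 : h z1 = 0) (h2 : h z2 = 0) (h3 : h z3 = ε) (h4 : h z4 = ε) {c η G : ℝ}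
    (hc : 0 < c) (hη : 0 < η) (hG : 0 < G)
    (s13 : c ≤ ‖mobius z1 z3‖) (s42 : c ≤ ‖mobius z4 z2‖) (s23 : η ≤ ‖mobius z2 z3‖)
    (g1 : G < ‖h 0‖ - 2 * ‖ε‖ / (c * η)) (g2 : G < ‖mobius ε (h 0)‖ - 2 * ‖ε‖ / (c * η)) :
    G ^ 2 < (‖z2‖ * ‖z3‖) ^ 2 * (‖z1‖ * ‖z4‖) := by
  have hS : SM h := ⟨hd, fun z hz => (hh z hz).le⟩
  have A := hS.three b1 b2 b3 n12 h1 h2 hc hη s13 s23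
  have B := (SM.mob hd hh he).three b4 b3 b2 n34.symm (by simp [h4, mob_self])
    (by simp [h3, mob_self]) hc hη s42 (by rw [mob_symm]; exact s23)
  simp only [h2, h3, mob_zero] at A B
  have Aone : G < ‖z1‖ * (‖z2‖ * ‖z3‖) := by linarith
  have Bone : G < ‖z4‖ * (‖z2‖ * ‖z3‖) := by linarith
  nlinarith [mul_lt_mul'' Aone Bone hG.le hG.le]

lemma elog_sum {x y z w : ℝ} (hx : x ≠ 0) (hy : y ≠ 0) (hz : z ≠ 0) (hw : w ≠ 0) :
    elog x + elog y + elog z + elog w = ((Real.log (x * y * z * w) : ℝ) : EReal) := by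
  unfold elog
  rw [if_neg hx, if_neg hy, if_neg hz, if_neg hw, Real.log_mul (by positivity) hw,
    Real.log_mul (by positivity) hz, Real.log_mul hx hy]
  push_cast; rfl

/-- Theorem `NoComan`: Coman's conjecture fails in the bidisc for equal weights.
With `b = -a` and `|a|^{3/2} < |γ| < |a|`, for all sufficiently small `ε ≠ 0`,
the pluricomplex Green function of the four equally weighted poles
`(a,0), (b,0), (b,ε), (a,ε)` at `(0,γ)` — which by Edigarian's product property equals
`max {2 log|a|, log|γ| + log|(ε-γ)/(1-ε̄γ)|}` — is strictly smaller than the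
corresponding Lempert function. -/
theorem no_coman
    (a γ : ℂ) (ha : a ∈ unitDisc) (ha0 : a ≠ 0)
    (h1 : (‖a‖) ^ ((3 : ℝ) / 2) < ‖γ‖)
    (h2 : ‖γ‖ < ‖a‖) :
    ∃ δ : ℝ, 0 < δ ∧ ∀ ε : ℂ, ε ≠ 0 → ‖ε‖ < δ →
      max ((2 * Real.log (‖a‖) : ℝ) : EReal)
          (((Real.log (‖γ‖) : ℝ) : EReal)
            + elog (‖(ε - γ) / (1 - (starRingEnd ℂ) ε * γ)‖))
        < Leps4 a (-a) ε (0, γ) := by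
  have har : ‖a‖ < 1 := mem_ball_zero_iff.1 ha
  have ra : 0 < ‖a‖ := norm_pos_iff.2 ha0
  obtain ⟨η, η0, hη⟩ := degenerate har ha0
  set w := ‖mobius a (-a)‖ with hw
  have w0 : 0 < w := by
    rw [hw, norm_pos_iff]
    refine mob_ne har (by simpa using har) ?_
    intro h
    exact ha0 (self_eq_neg.1 h)
  -- choice of constants
  obtain ⟨G, hG1, hG2⟩ := exists_between h1
  have hr : 0 < ‖a‖ ^ ((3 : ℝ) / 2) := Real.rpow_pos_of_pos ra _
  have G0 : 0 < G := hr.trans hG1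
  have hG3 : ‖a‖ ^ 3 < G ^ 2 := by
    have e : (‖a‖ ^ ((3 : ℝ) / 2)) ^ 2 = ‖a‖ ^ 3 := by
      rw [← Real.rpow_natCast, ← Real.rpow_mul ra.le, ← Real.rpow_natCast]
      norm_num
    rw [← e]
    exact pow_lt_pow_left₀ hG1 hr.le two_ne_zero
  obtain ⟨κ, κ0, κη, hκ⟩ : ∃ κ : ℝ, 0 < κ ∧ κ ≤ η ∧ (‖a‖ * (1 + κ)) ^ 3 < G ^ 2 := by
    have t : Tendsto (fun κ : ℝ => (‖a‖ * (1 + κ)) ^ 3) (𝓝[>] 0) (𝓝 ((‖a‖ * (1 + 0)) ^ 3)) :=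
      (Continuous.tendsto (by fun_prop) 0).mono_left nhdsWithin_le_nhds
    have e1 := t.eventually_lt_const (u := G ^ 2) (by simpa using hG3)
    have e2 : ∀ᶠ κ in 𝓝[>] (0:ℝ), κ ∈ Set.Ioo 0 η := Ioo_mem_nhdsGT η0
    obtain ⟨κ, k1, k2⟩ := (e1.and e2).exists
    exact ⟨κ, k2.1, k2.2.le, k1⟩
  have hγ1 : ‖γ‖ < 1 := h2.trans har
  have tm : Tendsto (fun ε : ℂ => ‖mobius ε γ‖) (𝓝 0) (𝓝 ‖γ‖) := by
    have : ContinuousAt (fun ε : ℂ => ‖mobius ε γ‖) 0 := by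
      unfold mobius
      refine ContinuousAt.norm (ContinuousAt.div (by fun_prop) ?_ (by simp))
      exact continuousAt_const.sub (Complex.continuous_conj.continuousAt.mul continuousAt_const)
    have h := this.tendsto
    simpa [mobius] using h
  have tc : Tendsto (fun ε : ℂ => 2 * ‖ε‖ / (w * η)) (𝓝 0) (𝓝 0) := by
    have : Continuous (fun ε : ℂ => 2 * ‖ε‖ / (w * η)) := by fun_prop
    simpa using this.tendsto 0
  have E1 : ∀ᶠ ε : ℂ in 𝓝 0, G < ‖γ‖ - 2 * ‖ε‖ / (w * η) :=
    (tendsto_const_nhds.sub tc).eventually_const_lt (by simpa using hG2)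
  have E2 : ∀ᶠ ε : ℂ in 𝓝 0, G < ‖mobius ε γ‖ - 2 * ‖ε‖ / (w * η) :=
    (tm.sub tc).eventually_const_lt (by simpa using hG2)
  have E3 : ∀ᶠ ε : ℂ in 𝓝 0, ‖mobius ε γ‖ < ‖a‖ := tm.eventually_lt_const h2
  obtain ⟨δ, δ0, hδ⟩ := Metric.eventually_nhds_iff.1 (E1.and (E2.and E3))
  refine ⟨min δ 1, lt_min δ0 one_pos, fun ε ε0 hε => ?_⟩
  obtain ⟨g1, g2, g3⟩ := hδ (y := ε) (by simpa using hε.trans_le (min_le_left _ _))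
  have he1 : ‖ε‖ < 1 := hε.trans_le (min_le_right _ _)
  have hpos : 0 ≤ 2 * ‖ε‖ / (w * η) := by positivity
  have m0 : 0 < ‖mobius ε γ‖ := by linarith
  have γ0 : 0 < ‖γ‖ := by linarith
  have hmax : max ((2 * Real.log (‖a‖) : ℝ) : EReal)
          (((Real.log (‖γ‖) : ℝ) : EReal)
            + elog (‖(ε - γ) / (1 - (starRingEnd ℂ) ε * γ)‖)) ≤
        ((2 * Real.log (‖a‖) : ℝ) : EReal) := by
    refine max_le le_rfl ?_
    rw [show (ε - γ) / (1 - (starRingEnd ℂ) ε * γ) = mobius ε γ from rfl]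
    unfold elog
    rw [if_neg m0.ne', ← EReal.coe_add, EReal.coe_le_coe_iff]
    have := Real.log_le_log m0 g3.le
    have := Real.log_le_log γ0 h2.le
    linarith
  have hlt : ((2 * Real.log (‖a‖) : ℝ) : EReal) < ((Real.log (‖a‖ ^ 2 * (1 + κ)) : ℝ) : EReal) := by
    rw [EReal.coe_lt_coe_iff, Real.log_mul (by positivity) (by positivity), Real.log_pow]
    have := Real.log_pos (show 1 < 1 + κ by linarith)
    push_cast; linarith
  refine (hmax.trans_lt hlt).trans_le ?_
  unfold Leps4
  refine le_sInf ?_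
  rintro t ⟨f, h, z1, z2, z3, z4, ⟨fd, hd, fm, hm⟩, b1, b2, b3, b4, f0, hh0, f1, hh1, f2, hh2,
    f3, hh3, f4, hh4, rfl⟩
  simp only at f0 hh0
  have toN : ∀ z : ℂ, z ∈ unitDisc ↔ ‖z‖ < 1 := fun z => mem_ball_zero_iff
  simp only [toN] at b1 b2 b3 b4 fm hm
  have nn : ∀ x y : ℂ, h x = 0 → h y = ε → x ≠ y := by
    rintro x y hx hy rfl
    exact ε0 (hy.symm.trans hx)
  have na : a ≠ -a := fun h => ha0 (self_eq_neg.1 h)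
  have nf : ∀ x y : ℂ, f x = a → f y = -a → x ≠ y := by
    rintro x y hx hy rfl
    exact na (hx.symm.trans hy)
  have nz : ∀ x, f x = a ∨ f x = -a → ‖x‖ ≠ 0 := by
    intro x hx h
    rw [norm_eq_zero] at h
    subst h
    rw [f0] at hx
    rcases hx with h | h
    · exact ha0 h.symm
    · exact ha0 (neg_eq_zero.1 h.symm)
  have D : Data a f z1 z2 z3 z4 := ⟨fd, fm, b1, b2, b3, b4, f0, f1, f2, f3, f4,
    nn _ _ hh1 hh4, nn _ _ hh2 hh3⟩
  rw [elog_sum (nz _ (.inl f1)) (nz _ (.inr f2)) (nz _ (.inr f3)) (nz _ (.inl f4)),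
    EReal.coe_le_coe_iff]
  refine Real.log_le_log (by positivity) ?_
  by_contra! hlt
  have A2 := half D.hd D.hf har D.b1 D.b4 D.b2 D.n14 D.f0 D.f1 D.f4 D.f2 ha0
  have A3 := half D.hd D.hf har D.b1 D.b4 D.b3 D.n14 D.f0 D.f1 D.f4 D.f3 ha0
  have Dsw := D.swap
  have B1 := half Dsw.hd Dsw.hf har Dsw.b1 Dsw.b4 Dsw.b2 Dsw.n14 Dsw.f0 Dsw.f1 Dsw.f4 Dsw.f2 ha0
  have P := A2.1
  have Q := B1.1
  have hA : ‖z1‖ * ‖z4‖ ≤ ‖a‖ * (1 + κ) := by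
    by_contra! hc
    have := mul_le_mul hc.le Q ra.le (by positivity)
    have hs : ‖z1‖ * ‖z4‖ * (‖z2‖ * ‖z3‖) = ‖z1‖ * ‖z2‖ * ‖z3‖ * ‖z4‖ := by ring
    have hs2 : ‖a‖ * (1 + κ) * ‖a‖ = ‖a‖ ^ 2 * (1 + κ) := by ring
    linarith
  have hB : ‖z2‖ * ‖z3‖ ≤ ‖a‖ * (1 + κ) := by
    by_contra! hc
    have := mul_le_mul hc.le P ra.le (by positivity)
    have hs : ‖z2‖ * ‖z3‖ * (‖z1‖ * ‖z4‖) = ‖z1‖ * ‖z2‖ * ‖z3‖ * ‖z4‖ := by ring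
    have hs2 : ‖a‖ * (1 + κ) * ‖a‖ = ‖a‖ ^ 2 * (1 + κ) := by ring
    linarith
  have hκη : ‖a‖ * (1 + κ) ≤ ‖a‖ * (1 + η) := by gcongr
  have fin : ∀ x y : ℝ, 0 ≤ x → 0 ≤ y → x ≤ ‖a‖ * (1 + κ) → y ≤ ‖a‖ * (1 + κ) →
      ¬ (G ^ 2 < x ^ 2 * y) := by
    intro x y hx hy hx' hy' h
    have : x ^ 2 * y ≤ (‖a‖ * (1 + κ)) ^ 2 * (‖a‖ * (1 + κ)) := by gcongr
    have hs : (‖a‖ * (1 + κ)) ^ 2 * (‖a‖ * (1 + κ)) = (‖a‖ * (1 + κ)) ^ 3 := by ring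
    linarith
  subst hh0
  by_cases c1 : ‖mobius z2 z3‖ < η
  · by_cases c2 : ‖mobius z1 z4‖ < η
    · exact hη f z1 z2 z3 z4 D (hA.trans hκη) (hB.trans hκη) c2 c1
    · push Not at c2
      refine fin (‖z1‖ * ‖z4‖) (‖z2‖ * ‖z3‖) (by positivity) (by positivity) hA hB ?_
      refine sep_case hd hm b2 b1 b4 b3 (nf _ _ f1 f2).symm (nf _ _ f4 f3) he1 hh2 hh1 hh4 hh3
        w0 η0 G0 ?_ ?_ c2 g1 g2
      · rw [mob_symm]; exact A2.2.2.1
      · rw [mob_symm]; exact A3.2.1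
  · push Not at c1
    refine fin (‖z2‖ * ‖z3‖) (‖z1‖ * ‖z4‖) (by positivity) (by positivity) hB hA ?_
    exact sep_case hd hm b1 b2 b3 b4 (nf _ _ f1 f2) (nf _ _ f4 f3).symm he1 hh1 hh2 hh3 hh4
        w0 η0 G0 A3.2.1 A2.2.2.1 c1 g1 g2
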